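/- Let H be a Hopf algebra and K a Hopf algebra, with P a K-H-bicomodule algebra such that B = P^{coH} ⊆ P is a right H-Galois extension. If γ is a convolution-invertible 2-cocycle on K, then the formula Γ(p ⊗ q, p' ⊗ q') := γ(p₍₋₁₎, p'₍₋₁₎) p₍₀₎ p'₍₀₎ q' q defines a map Γ: L(P,H) ⊗ L(P,H) → B satisfying the left-bialgebroid 2-cocycle conditions: Γ(1, X) = ε(X) = Γ(X, 1) and Γ(X, Γ(Y₁, Z₁)Y₂Z₂) = Γ(Γ(X₁, Y₁)X₂Y₂, Z). -/

import Mathlib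

/-!
STATEMENT 16: Let `H, K` be Hopf algebras and `P` a `K`-`H`-bicomodule
algebra such that `B = P^{coH} ⊆ P` is a right `H`-Galois extension.  If `γ`
is a convolution-invertible 2-cocycle on `K`, then
`Γ(p ⊗ q, p' ⊗ q') := γ(p₍₋₁₎, p'₍₋₁₎) p₍₀₎ p'₍₀₎ q' q` defines a map
`Γ : L(P,H) ⊗ L(P,H) → B` satisfying the left-bialgebroid 2-cocycle
conditions `Γ(1, X) = ε(X) = Γ(X, 1)` and
`Γ(X, Γ(Y₁, Z₁) Y₂ Z₂) = Γ(Γ(X₁, Y₁) X₂ Y₂, Z)`,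
where `Δ(p ⊗ q) = (p₍₀₎ ⊗ (p₍₁₎)⁽¹⁾) ⊗ ((p₍₁₎)⁽²⁾ ⊗ q)` is the Ehresmann
coproduct, `ε(p ⊗ q) = pq` the counit, and `b · Y = (b ⊗ 1) Y`.

`L(P,H)` is realised inside `A := P ⊗ Pᵐᵒᵖ`.
-/

open TensorProduct LinearMap MulOpposite

noncomputable section

variable (k H K P : Type) [Field k] [Ring H] [HopfAlgebra k H]
  [Ring K] [HopfAlgebra k K] [Ring P] [Algebra k P]



/-- `δ` is a (coassociative, counital) right `H`-comodule structure on `P`. -/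
def IsRightComodule (δ : P →ₗ[k] P ⊗[k] H) : Prop :=
  (∀ p, (TensorProduct.rid k P) ((lTensor P Coalgebra.counit) (δ p)) = p) ∧
  (∀ p, (TensorProduct.assoc k P H H) ((rTensor H δ) (δ p))
      = (lTensor P Coalgebra.comul) (δ p))

/-- `δ` makes `P` a right `H`-comodule algebra. -/
def IsComodAlg (δ : P →ₗ[k] P ⊗[k] H) : Prop :=
  IsRightComodule k H P δ ∧ (∀ p q : P, δ (p * q) = δ p * δ q) ∧ δ 1 = 1

/-- The coinvariant subalgebra `B = P^{coH}` (as a subset). -/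
def coinv (δ : P →ₗ[k] P ⊗[k] H) : Set P := {p | δ p = p ⊗ₜ[k] (1 : H)}

/-- The canonical Galois map lifted to `P ⊗_k P`: `p ⊗ q ↦ p q₍₀₎ ⊗ q₍₁₎`. -/
def canMap (δ : P →ₗ[k] P ⊗[k] H) : P ⊗[k] P →ₗ[k] P ⊗[k] H :=
  (rTensor H (mul' k P)) ∘ₗ (TensorProduct.assoc k P P H).symm.toLinearMap ∘ₗ
    (lTensor P δ)

/-- The `B`-balancing relations defining `P ⊗_B P` inside `P ⊗_k P`. -/
def galRel (δ : P →ₗ[k] P ⊗[k] H) : Submodule k (P ⊗[k] P) :=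
  Submodule.span k {z | ∃ p q b, b ∈ coinv k H P δ ∧
    z = (p * b) ⊗ₜ[k] q - p ⊗ₜ[k] (b * q)}

/-- `B ⊆ P` is a right `H`-Galois extension: the canonical map descends to a
bijection `P ⊗_B P → P ⊗ H`. -/
def IsGaloisExt (δ : P →ₗ[k] P ⊗[k] H) : Prop :=
  Function.Surjective (canMap k H P δ) ∧ ker (canMap k H P δ) = galRel k H P δ

/-- The codiagonal right `H`-coaction on `P ⊗ Pᵐᵒᵖ`:
`p ⊗ q ↦ (p₍₀₎ ⊗ q₍₀₎) ⊗ p₍₁₎ q₍₁₎`. -/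
def codiagCoaction (δ : P →ₗ[k] P ⊗[k] H) :
    P ⊗[k] Pᵐᵒᵖ →ₗ[k] (P ⊗[k] Pᵐᵒᵖ) ⊗[k] H :=
  (lTensor (P ⊗[k] Pᵐᵒᵖ) (mul' k H)) ∘ₗ
    (TensorProduct.tensorTensorTensorComm k P H Pᵐᵒᵖ H).toLinearMap ∘ₗ
    (TensorProduct.map δ
      ((rTensor H (MulOpposite.opLinearEquiv k (M := P)).toLinearMap) ∘ₗ δ ∘ₗ
        (MulOpposite.opLinearEquiv k (M := P)).symm.toLinearMap))

/-- The Ehresmann bialgebroid `L(P,H) ⊆ P ⊗ Pᵐᵒᵖ`: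
coinvariants of the codiagonal coaction. -/
def ehresmann (δ : P →ₗ[k] P ⊗[k] H) : Set (P ⊗[k] Pᵐᵒᵖ) :=
  {x | codiagCoaction k H P δ x = x ⊗ₜ[k] (1 : H)}

/-- `δK` is a (coassociative, counital) left `K`-comodule structure on `P`. -/
def IsLeftComodule (δK : P →ₗ[k] K ⊗[k] P) : Prop :=
  (∀ p, (TensorProduct.lid k P) ((rTensor P Coalgebra.counit) (δK p)) = p) ∧
  (∀ p, (rTensor P Coalgebra.comul) (δK p)
      = (TensorProduct.assoc k K K P).symm ((lTensor K δK) (δK p)))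

/-- `δK` makes `P` a left `K`-comodule algebra. -/
def IsLeftComodAlg (δK : P →ₗ[k] K ⊗[k] P) : Prop :=
  IsLeftComodule k K P δK ∧ (∀ p q : P, δK (p * q) = δK p * δK q) ∧ δK 1 = 1

/-- Comultiplication iterated once: `x ↦ x₁ ⊗ (x₂ ⊗ x₃)`. -/
def comul₂ : K →ₗ[k] K ⊗[k] (K ⊗[k] K) :=
  (lTensor K Coalgebra.comul) ∘ₗ Coalgebra.comul

/-- Convolution product of two functionals on the coalgebra `K ⊗ K`. -/
def convKK (γ γ' : K ⊗[k] K →ₗ[k] k) : K ⊗[k] K →ₗ[k] k :=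
  (TensorProduct.lid k k).toLinearMap ∘ₗ (TensorProduct.map γ γ') ∘ₗ
    (Coalgebra.comul (R := k) (A := K ⊗[k] K))

/-- LHS of the 2-cocycle condition: `γ(x₁, y₁) γ(x₂ y₂, z)`. -/
def cocycleLHS (γ : K ⊗[k] K →ₗ[k] k) : (K ⊗[k] K) ⊗[k] K →ₗ[k] k :=
  (TensorProduct.lid k k).toLinearMap ∘ₗ
    (TensorProduct.map γ (γ ∘ₗ rTensor K (mul' k K))) ∘ₗ
    (TensorProduct.assoc k (K ⊗[k] K) (K ⊗[k] K) K).toLinearMap ∘ₗ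
    (rTensor K (Coalgebra.comul (R := k) (A := K ⊗[k] K)))

/-- RHS of the 2-cocycle condition: `γ(y₁, z₁) γ(x, y₂ z₂)`. -/
def cocycleRHS (γ : K ⊗[k] K →ₗ[k] k) : K ⊗[k] (K ⊗[k] K) →ₗ[k] k :=
  (TensorProduct.lid k k).toLinearMap ∘ₗ
    (TensorProduct.map γ (γ ∘ₗ lTensor K (mul' k K))) ∘ₗ
    (TensorProduct.leftComm k K (K ⊗[k] K) (K ⊗[k] K)).toLinearMap ∘ₗ
    (lTensor K (Coalgebra.comul (R := k) (A := K ⊗[k] K)))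

/-- `γ` is a convolution-invertible 2-cocycle on `K` with inverse `γinv`. -/
def IsTwoCocycle (γ γinv : K ⊗[k] K →ₗ[k] k) : Prop :=
  convKK k K γ γinv = Coalgebra.counit ∧
  convKK k K γinv γ = Coalgebra.counit ∧
  cocycleLHS k K γ
      = cocycleRHS k K γ ∘ₗ (TensorProduct.assoc k K K K).toLinearMap ∧
  (∀ x : K, γ ((1 : K) ⊗ₜ[k] x) = Coalgebra.counit x) ∧
  (∀ x : K, γ (x ⊗ₜ[k] (1 : K)) = Coalgebra.counit x)

/-- The left `K`-coaction on `A = P ⊗ Pᵐᵒᵖ` (through the first leg). -/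
def deltaKA (δK : P →ₗ[k] K ⊗[k] P) :
    P ⊗[k] Pᵐᵒᵖ →ₗ[k] K ⊗[k] (P ⊗[k] Pᵐᵒᵖ) :=
  (TensorProduct.assoc k K P Pᵐᵒᵖ).toLinearMap ∘ₗ (rTensor Pᵐᵒᵖ δK)

/-- The Ehresmann counit `ε : A → P`, `p ⊗ q ↦ p q`. -/
def epsL : P ⊗[k] Pᵐᵒᵖ →ₗ[k] P :=
  (mul' k P) ∘ₗ
    (TensorProduct.map LinearMap.id (opLinearEquiv k (M := P)).symm.toLinearMap)

/-- The induced 2-cochain `Γ : A ⊗ A → P`,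
`(p ⊗ q) ⊗ (p' ⊗ q') ↦ γ(p₍₋₁₎, p'₍₋₁₎) p₍₀₎ p'₍₀₎ q' q`. -/
def GammaMap (δK : P →ₗ[k] K ⊗[k] P) (γ : K ⊗[k] K →ₗ[k] k) :
    (P ⊗[k] Pᵐᵒᵖ) ⊗[k] (P ⊗[k] Pᵐᵒᵖ) →ₗ[k] P :=
  (TensorProduct.lid k P).toLinearMap ∘ₗ
    (TensorProduct.map γ (epsL k P ∘ₗ mul' k (P ⊗[k] Pᵐᵒᵖ))) ∘ₗ
    (TensorProduct.tensorTensorTensorComm k K (P ⊗[k] Pᵐᵒᵖ)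
      K (P ⊗[k] Pᵐᵒᵖ)).toLinearMap ∘ₗ
    (TensorProduct.map (deltaKA k K P δK) (deltaKA k K P δK))

/-- The (lifted) Ehresmann coproduct `Δ : A → A ⊗ A`,
`p ⊗ q ↦ (p₍₀₎ ⊗ (p₍₁₎)⁽¹⁾) ⊗ ((p₍₁₎)⁽²⁾ ⊗ q)`. -/
def deltaEhr (δ : P →ₗ[k] P ⊗[k] H) (τ : H →ₗ[k] P ⊗[k] P) :
    P ⊗[k] Pᵐᵒᵖ →ₗ[k] (P ⊗[k] Pᵐᵒᵖ) ⊗[k] (P ⊗[k] Pᵐᵒᵖ) :=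
  (rTensor (P ⊗[k] Pᵐᵒᵖ)
      (lTensor P (opLinearEquiv k (M := P)).toLinearMap)) ∘ₗ
    (TensorProduct.assoc k (P ⊗[k] P) P Pᵐᵒᵖ).toLinearMap ∘ₗ
    (rTensor Pᵐᵒᵖ (TensorProduct.assoc k P P P).symm.toLinearMap) ∘ₗ
    (rTensor Pᵐᵒᵖ (lTensor P τ)) ∘ₗ
    (rTensor Pᵐᵒᵖ δ)

/-- The embedding `B → A`, `b ↦ b ⊗ 1` (source map). -/
def toA : P →ₗ[k] P ⊗[k] Pᵐᵒᵖ :=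
  (TensorProduct.mk k P Pᵐᵒᵖ).flip (op (1 : P))

/-- `(Y₁ ⊗ Y₂) ⊗ (Z₁ ⊗ Z₂) ↦ (Γ(Y₁, Z₁) ⊗ 1) · Y₂ Z₂`. -/
def cocyInner (δK : P →ₗ[k] K ⊗[k] P) (γ : K ⊗[k] K →ₗ[k] k) :
    ((P ⊗[k] Pᵐᵒᵖ) ⊗[k] (P ⊗[k] Pᵐᵒᵖ)) ⊗[k]
      ((P ⊗[k] Pᵐᵒᵖ) ⊗[k] (P ⊗[k] Pᵐᵒᵖ)) →ₗ[k] P ⊗[k] Pᵐᵒᵖ :=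
  (mul' k (P ⊗[k] Pᵐᵒᵖ)) ∘ₗ
    (TensorProduct.map (toA k P ∘ₗ GammaMap k K P δK γ)
      (mul' k (P ⊗[k] Pᵐᵒᵖ))) ∘ₗ
    (TensorProduct.tensorTensorTensorComm k (P ⊗[k] Pᵐᵒᵖ) (P ⊗[k] Pᵐᵒᵖ)
      (P ⊗[k] Pᵐᵒᵖ) (P ⊗[k] Pᵐᵒᵖ)).toLinearMap

section TwistedMultiplication

variable {k H K P} {M N : Type} [Ring M] [Algebra k M] [Ring N] [Algebra k N]

/-- The multiplication of `M` twisted by a functional `γ` on `K ⊗ K`: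
`(a ⊗ m) ⊗ (b ⊗ n) ↦ γ(a, b) m n`. -/
def twistedMul (γ : K ⊗[k] K →ₗ[k] k) :
    (K ⊗[k] M) ⊗[k] (K ⊗[k] M) →ₗ[k] M :=
  (TensorProduct.lid k M).toLinearMap ∘ₗ (TensorProduct.map γ (mul' k M)) ∘ₗ
    (TensorProduct.tensorTensorTensorComm k K M K M).toLinearMap

@[simp]
theorem twistedMul_tmul (γ : K ⊗[k] K →ₗ[k] k) (a b : K) (m n : M) :
    twistedMul γ ((a ⊗ₜ[k] m) ⊗ₜ[k] (b ⊗ₜ[k] n)) = γ (a ⊗ₜ[k] b) • (m * n) := by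
  simp [twistedMul]

theorem map_twistedMul (γ : K ⊗[k] K →ₗ[k] k) (f : M →ₗ[k] N)
    (hf : ∀ m n, f (m * n) = f m * f n) (u v : K ⊗[k] M) :
    f (twistedMul γ (u ⊗ₜ[k] v))
      = twistedMul γ (lTensor K f u ⊗ₜ[k] lTensor K f v) := by
  induction u using TensorProduct.induction_on with
  | zero => simp
  | add u u' hu hu' => simp only [add_tmul, map_add, hu, hu']
  | tmul a m =>
    induction v using TensorProduct.induction_on with
    | zero => simp
    | add v v' hv hv' => simp only [tmul_add, map_add, hv, hv']
    | tmul b n => simp [hf]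

/-- The product `x ⋆ y = γ(x₍₋₁₎, y₍₋₁₎) x₍₀₎ y₍₀₎` on `P`. -/
def twistedProd (δK : P →ₗ[k] K ⊗[k] P) (γ : K ⊗[k] K →ₗ[k] k) : P →ₗ[k] P →ₗ[k] P :=
  TensorProduct.curry (twistedMul γ ∘ₗ TensorProduct.map δK δK)

theorem twistedProd_apply (δK : P →ₗ[k] K ⊗[k] P) (γ : K ⊗[k] K →ₗ[k] k) (x y : P) :
    twistedProd δK γ x y = twistedMul γ (δK x ⊗ₜ[k] δK y) :=
  rfl

theorem twistedMul_twistedMul_left (γ : K ⊗[k] K →ₗ[k] k) (u v : K ⊗[k] K) (a : K)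
    (x y z : M) :
    twistedMul γ (twistedMul γ (TensorProduct.assoc k K K M (u ⊗ₜ[k] x) ⊗ₜ[k]
        TensorProduct.assoc k K K M (v ⊗ₜ[k] y)) ⊗ₜ[k] (a ⊗ₜ[k] z))
      = TensorProduct.lid k k (TensorProduct.map γ (γ ∘ₗ rTensor K (mul' k K))
          (TensorProduct.assoc k (K ⊗[k] K) (K ⊗[k] K) K
            (TensorProduct.tensorTensorTensorComm k K K K K (u ⊗ₜ[k] v) ⊗ₜ[k] a)))
        • (x * y * z) := by
  induction u using TensorProduct.induction_on with
  | zero => simp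
  | add u u' hu hu' => simp only [add_tmul, map_add, add_smul, hu, hu']
  | tmul b b' =>
    induction v using TensorProduct.induction_on with
    | zero => simp
    | add v v' hv hv' => simp only [add_tmul, tmul_add, map_add, add_smul, hv, hv']
    | tmul c c' => simp [← smul_tmul', mul_smul]

theorem twistedMul_twistedMul_right (γ : K ⊗[k] K →ₗ[k] k) (u v : K ⊗[k] K) (a : K)
    (x y z : M) :
    twistedMul γ ((a ⊗ₜ[k] x) ⊗ₜ[k] twistedMul γ
        (TensorProduct.assoc k K K M (u ⊗ₜ[k] y) ⊗ₜ[k]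
          TensorProduct.assoc k K K M (v ⊗ₜ[k] z)))
      = TensorProduct.lid k k (TensorProduct.map γ (γ ∘ₗ lTensor K (mul' k K))
          (TensorProduct.leftComm k K (K ⊗[k] K) (K ⊗[k] K)
            (a ⊗ₜ[k] TensorProduct.tensorTensorTensorComm k K K K K (u ⊗ₜ[k] v))))
        • (x * (y * z)) := by
  induction u using TensorProduct.induction_on with
  | zero => simp
  | add u u' hu hu' => simp only [add_tmul, tmul_add, map_add, add_smul, hu, hu']
  | tmul b b' =>
    induction v using TensorProduct.induction_on with
    | zero => simp
    | add v v' hv hv' => simp only [add_tmul, tmul_add, map_add, add_smul, hv, hv']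
    | tmul c c' => simp [mul_smul]

theorem twistedMul_comul_assoc (γ : K ⊗[k] K →ₗ[k] k)
    (hγ : cocycleLHS k K γ
      = cocycleRHS k K γ ∘ₗ (TensorProduct.assoc k K K K).toLinearMap)
    (u v w : K ⊗[k] M) :
    twistedMul γ (twistedMul γ
        (TensorProduct.assoc k K K M (rTensor M Coalgebra.comul u) ⊗ₜ[k]
          TensorProduct.assoc k K K M (rTensor M Coalgebra.comul v)) ⊗ₜ[k] w)
      = twistedMul γ (u ⊗ₜ[k] twistedMul γ
        (TensorProduct.assoc k K K M (rTensor M Coalgebra.comul v) ⊗ₜ[k]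
          TensorProduct.assoc k K K M (rTensor M Coalgebra.comul w))) := by
  induction u using TensorProduct.induction_on with
  | zero => simp
  | add u u' hu hu' => simp only [add_tmul, map_add, hu, hu']
  | tmul a x =>
    induction v using TensorProduct.induction_on with
    | zero => simp
    | add v v' hv hv' => simp only [add_tmul, tmul_add, map_add, hv, hv']
    | tmul b y =>
      induction w using TensorProduct.induction_on with
      | zero => simp
      | add w w' hw hw' => simp only [tmul_add, map_add, hw, hw']
      | tmul c z =>
        have h := LinearMap.congr_fun hγ ((a ⊗ₜ[k] b) ⊗ₜ[k] c)
        simp only [cocycleLHS, cocycleRHS, coe_comp, LinearEquiv.coe_coe,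
          Function.comp_apply, rTensor_tmul, lTensor_tmul, assoc_tmul,
          TensorProduct.comul_tmul] at h
        simp only [rTensor_tmul]
        rw [twistedMul_twistedMul_left, twistedMul_twistedMul_right, mul_assoc]
        exact congrArg (· • (x * (y * z))) h

theorem comodule_twistedProd {δK : P →ₗ[k] K ⊗[k] P} (hδK : IsLeftComodAlg k K P δK)
    (γ : K ⊗[k] K →ₗ[k] k) (x y : P) :
    δK (twistedProd δK γ x y) = twistedMul γ
      (TensorProduct.assoc k K K P (rTensor P Coalgebra.comul (δK x)) ⊗ₜ[k]
        TensorProduct.assoc k K K P (rTensor P Coalgebra.comul (δK y))) := by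
  rw [twistedProd_apply, map_twistedMul γ δK hδK.2.1, hδK.1.2 x, hδK.1.2 y]
  simp

theorem twistedProd_assoc {δK : P →ₗ[k] K ⊗[k] P} (hδK : IsLeftComodAlg k K P δK)
    (γ : K ⊗[k] K →ₗ[k] k)
    (hγ : cocycleLHS k K γ
      = cocycleRHS k K γ ∘ₗ (TensorProduct.assoc k K K K).toLinearMap) (x y z : P) :
    twistedProd δK γ (twistedProd δK γ x y) z
      = twistedProd δK γ x (twistedProd δK γ y z) := by
  rw [twistedProd_apply, comodule_twistedProd hδK, twistedMul_comul_assoc γ hγ,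
    ← comodule_twistedProd hδK]
  rfl

theorem one_twistedProd {δK : P →ₗ[k] K ⊗[k] P} (hδK : IsLeftComodAlg k K P δK)
    (γ : K ⊗[k] K →ₗ[k] k) (hγ : ∀ x : K, γ ((1 : K) ⊗ₜ[k] x) = Coalgebra.counit x)
    (x : P) : twistedProd δK γ 1 x = x := by
  have h (u : K ⊗[k] P) : twistedMul γ ((1 : K ⊗[k] P) ⊗ₜ[k] u)
      = TensorProduct.lid k P (rTensor P Coalgebra.counit u) := by
    induction u using TensorProduct.induction_on with
    | zero => simp
    | add u u' hu hu' => simp only [tmul_add, map_add, hu, hu']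
    | tmul a p => simp [Algebra.TensorProduct.one_def, hγ]
  rw [twistedProd_apply, hδK.2.2, h, hδK.1.1]

theorem twistedProd_one {δK : P →ₗ[k] K ⊗[k] P} (hδK : IsLeftComodAlg k K P δK)
    (γ : K ⊗[k] K →ₗ[k] k) (hγ : ∀ x : K, γ (x ⊗ₜ[k] (1 : K)) = Coalgebra.counit x)
    (x : P) : twistedProd δK γ x 1 = x := by
  have h (u : K ⊗[k] P) : twistedMul γ (u ⊗ₜ[k] (1 : K ⊗[k] P))
      = TensorProduct.lid k P (rTensor P Coalgebra.counit u) := by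
    induction u using TensorProduct.induction_on with
    | zero => simp
    | add u u' hu hu' => simp only [add_tmul, map_add, hu, hu']
    | tmul a p => simp [Algebra.TensorProduct.one_def, hγ]
  rw [twistedProd_apply, hδK.2.2, h, hδK.1.1]

end TwistedMultiplication

section Ehresmann

variable {k H K P}

theorem GammaMap_tmul (δK : P →ₗ[k] K ⊗[k] P) (γ : K ⊗[k] K →ₗ[k] k) (p p' : P)
    (q q' : Pᵐᵒᵖ) :
    GammaMap k K P δK γ ((p ⊗ₜ[k] q) ⊗ₜ[k] (p' ⊗ₜ[k] q'))
      = twistedProd δK γ p p' * (unop q' * unop q) := by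
  have h (u v : K ⊗[k] P) :
      TensorProduct.lid k P (TensorProduct.map γ (epsL k P ∘ₗ mul' k (P ⊗[k] Pᵐᵒᵖ))
        (TensorProduct.tensorTensorTensorComm k K (P ⊗[k] Pᵐᵒᵖ) K (P ⊗[k] Pᵐᵒᵖ)
          (TensorProduct.assoc k K P Pᵐᵒᵖ (u ⊗ₜ[k] q) ⊗ₜ[k]
            TensorProduct.assoc k K P Pᵐᵒᵖ (v ⊗ₜ[k] q'))))
      = twistedMul γ (u ⊗ₜ[k] v) * (unop q' * unop q) := by
    induction u using TensorProduct.induction_on with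
    | zero => simp
    | add u u' hu hu' => simp only [add_tmul, map_add, add_mul, hu, hu']
    | tmul a m =>
      induction v using TensorProduct.induction_on with
      | zero => simp
      | add v v' hv hv' => simp only [add_tmul, tmul_add, map_add, add_mul, hv, hv']
      | tmul b n => simp [epsL]
  simpa [GammaMap, deltaKA, twistedProd_apply] using h (δK p) (δK p')

theorem mul'_translation {δ : P →ₗ[k] P ⊗[k] H} (hδ : IsRightComodule k H P δ)
    {h : H} {t : P ⊗[k] P} (ht : canMap k H P δ t = (1 : P) ⊗ₜ[k] h) :
    mul' k P t = algebraMap k P (Coalgebra.counit h) := by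
  have key (t : P ⊗[k] P) : TensorProduct.rid k P (lTensor P Coalgebra.counit
      (canMap k H P δ t)) = mul' k P t := by
    induction t using TensorProduct.induction_on with
    | zero => simp
    | add t t' ht ht' => simp only [map_add, ht, ht']
    | tmul p q =>
      have (u : P ⊗[k] H) : TensorProduct.rid k P (lTensor P Coalgebra.counit
          (rTensor H (mul' k P) ((TensorProduct.assoc k P P H).symm (p ⊗ₜ[k] u))))
          = p * TensorProduct.rid k P (lTensor P Coalgebra.counit u) := by
        induction u using TensorProduct.induction_on with
        | zero => simp
        | add u u' hu hu' => simp only [tmul_add, map_add, mul_add, hu, hu']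
        | tmul r h => simp
      simpa [canMap, hδ.1 q] using this (δ q)
  rw [← key, ht]
  simp [Algebra.algebraMap_eq_smul_one]

/-- The image of `t` under `P ⊗ P → A ⊗ A`, `t₁ ⊗ t₂ ↦ (p ⊗ t₁) ⊗ (t₂ ⊗ q)`. -/
def translationInsert (p : P) (q : Pᵐᵒᵖ) :
    P ⊗[k] P →ₗ[k] (P ⊗[k] Pᵐᵒᵖ) ⊗[k] (P ⊗[k] Pᵐᵒᵖ) :=
  TensorProduct.map (TensorProduct.mk k P Pᵐᵒᵖ p ∘ₗ (opLinearEquiv k).toLinearMap)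
    ((TensorProduct.mk k P Pᵐᵒᵖ).flip q)

theorem cocyInner_translationInsert (δK : P →ₗ[k] K ⊗[k] P) (γ : K ⊗[k] K →ₗ[k] k)
    (p p' : P) (q q' : Pᵐᵒᵖ) (s t : P ⊗[k] P) {a b : k}
    (hs : mul' k P s = algebraMap k P a) (ht : mul' k P t = algebraMap k P b) :
    cocyInner k K P δK γ (translationInsert p q s ⊗ₜ[k] translationInsert p' q' t)
      = (a • b • twistedProd δK γ p p') ⊗ₜ[k] (q * q') := by
  have hst (r r' : P) : cocyInner k K P δK γ
      (translationInsert p q s ⊗ₜ[k] translationInsert p' q' (r ⊗ₜ[k] r'))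
      = (twistedProd δK γ p p' * (r * mul' k P s * r')) ⊗ₜ[k] (q * q') := by
    clear hs
    induction s using TensorProduct.induction_on with
    | zero => simp
    | add s s' hs hs' => simp only [add_tmul, map_add, mul_add, add_mul, hs, hs']
    | tmul m m' => simp [cocyInner, translationInsert, toA, GammaMap_tmul, mul_assoc]
  have htt : cocyInner k K P δK γ (translationInsert p q s ⊗ₜ[k] translationInsert p' q' t)
      = (a • (twistedProd δK γ p p' * mul' k P t)) ⊗ₜ[k] (q * q') := by
    clear ht
    induction t using TensorProduct.induction_on with
    | zero => simp
    | add t t' ht ht' => simp only [add_tmul, tmul_add, map_add, mul_add, smul_add, ht, ht']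
    | tmul m m' => simp [hst, hs, Algebra.algebraMap_eq_smul_one]
  rw [htt, ht]
  simp [Algebra.algebraMap_eq_smul_one]

theorem cocyInner_deltaEhr {δ : P →ₗ[k] P ⊗[k] H} (hδ : IsRightComodule k H P δ)
    (δK : P →ₗ[k] K ⊗[k] P) (γ : K ⊗[k] K →ₗ[k] k) {τ : H →ₗ[k] P ⊗[k] P}
    (hτ : ∀ h : H, canMap k H P δ (τ h) = (1 : P) ⊗ₜ[k] h) (p p' : P) (q q' : Pᵐᵒᵖ) :
    cocyInner k K P δK γ
        (deltaEhr k H P δ τ (p ⊗ₜ[k] q) ⊗ₜ[k] deltaEhr k H P δ τ (p' ⊗ₜ[k] q'))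
      = twistedProd δK γ p p' ⊗ₜ[k] (q * q') := by
  have hins (p : P) (q : Pᵐᵒᵖ) (t : P ⊗[k] P) :
      rTensor (P ⊗[k] Pᵐᵒᵖ) (lTensor P (opLinearEquiv k (M := P)).toLinearMap)
        (TensorProduct.assoc k (P ⊗[k] P) P Pᵐᵒᵖ
          ((TensorProduct.assoc k P P P).symm (p ⊗ₜ[k] t) ⊗ₜ[k] q))
      = translationInsert p q t := by
    induction t using TensorProduct.induction_on with
    | zero => simp
    | add t t' ht ht' => simp only [add_tmul, tmul_add, map_add, ht, ht']
    | tmul m m' => simp [translationInsert]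
  let D (q : Pᵐᵒᵖ) : P ⊗[k] H →ₗ[k] (P ⊗[k] Pᵐᵒᵖ) ⊗[k] (P ⊗[k] Pᵐᵒᵖ) :=
    rTensor (P ⊗[k] Pᵐᵒᵖ) (lTensor P (opLinearEquiv k (M := P)).toLinearMap) ∘ₗ
      (TensorProduct.assoc k (P ⊗[k] P) P Pᵐᵒᵖ).toLinearMap ∘ₗ
      (TensorProduct.mk k _ Pᵐᵒᵖ).flip q ∘ₗ
      (TensorProduct.assoc k P P P).symm.toLinearMap ∘ₗ lTensor P τ
  have hD (q : Pᵐᵒᵖ) (p : P) (h : H) : D q (p ⊗ₜ[k] h) = translationInsert p q (τ h) :=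
    hins p q (τ h)
  have key (u v : P ⊗[k] H) : cocyInner k K P δK γ (D q u ⊗ₜ[k] D q' v)
      = twistedProd δK γ (TensorProduct.rid k P (lTensor P Coalgebra.counit u))
        (TensorProduct.rid k P (lTensor P Coalgebra.counit v)) ⊗ₜ[k] (q * q') := by
    induction u using TensorProduct.induction_on with
    | zero => simp
    | add u u' hu hu' => simp only [add_tmul, map_add, LinearMap.add_apply, hu, hu']
    | tmul m h =>
      induction v using TensorProduct.induction_on with
      | zero => simp
      | add v v' hv hv' => simp only [add_tmul, tmul_add, map_add, hv, hv']
      | tmul m' h' =>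
        rw [hD, hD, cocyInner_translationInsert δK γ m m' q q' _ _
          (mul'_translation hδ (hτ h)) (mul'_translation hδ (hτ h')), smul_comm]
        simp
  have hkey := key (δ p) (δ p')
  rw [hδ.1, hδ.1] at hkey
  exact hkey

theorem GammaMap_cocycle {δ : P →ₗ[k] P ⊗[k] H} (hδ : IsRightComodule k H P δ)
    {δK : P →ₗ[k] K ⊗[k] P} (hδK : IsLeftComodAlg k K P δK) {τ : H →ₗ[k] P ⊗[k] P}
    (hτ : ∀ h : H, canMap k H P δ (τ h) = (1 : P) ⊗ₜ[k] h) {γ : K ⊗[k] K →ₗ[k] k}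
    (hγ : cocycleLHS k K γ
      = cocycleRHS k K γ ∘ₗ (TensorProduct.assoc k K K K).toLinearMap)
    (x y z : P ⊗[k] Pᵐᵒᵖ) :
    GammaMap k K P δK γ (x ⊗ₜ[k] cocyInner k K P δK γ
        (deltaEhr k H P δ τ y ⊗ₜ[k] deltaEhr k H P δ τ z))
      = GammaMap k K P δK γ (cocyInner k K P δK γ
        (deltaEhr k H P δ τ x ⊗ₜ[k] deltaEhr k H P δ τ y) ⊗ₜ[k] z) := by
  induction x using TensorProduct.induction_on with
  | zero => simp
  | add x x' hx hx' => simp only [add_tmul, map_add, hx, hx']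
  | tmul p q =>
    induction y using TensorProduct.induction_on with
    | zero => simp
    | add y y' hy hy' => simp only [add_tmul, tmul_add, map_add, hy, hy']
    | tmul p' q' =>
      induction z using TensorProduct.induction_on with
      | zero => simp
      | add z z' hz hz' => simp only [tmul_add, map_add, hz, hz']
      | tmul p'' q'' =>
        simp only [cocyInner_deltaEhr hδ δK γ hτ, GammaMap_tmul,
          twistedProd_assoc hδK γ hγ, unop_mul, mul_assoc]

theorem GammaMap_one_left {δK : P →ₗ[k] K ⊗[k] P} (hδK : IsLeftComodAlg k K P δK)
    {γ : K ⊗[k] K →ₗ[k] k} (hγ : ∀ x : K, γ ((1 : K) ⊗ₜ[k] x) = Coalgebra.counit x)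
    (x : P ⊗[k] Pᵐᵒᵖ) :
    GammaMap k K P δK γ ((1 : P ⊗[k] Pᵐᵒᵖ) ⊗ₜ[k] x) = epsL k P x := by
  induction x using TensorProduct.induction_on with
  | zero => simp
  | add x x' hx hx' => simp only [tmul_add, map_add, hx, hx']
  | tmul p q =>
    simp [Algebra.TensorProduct.one_def, GammaMap_tmul, one_twistedProd hδK γ hγ, epsL]

theorem GammaMap_one_right {δK : P →ₗ[k] K ⊗[k] P} (hδK : IsLeftComodAlg k K P δK)
    {γ : K ⊗[k] K →ₗ[k] k} (hγ : ∀ x : K, γ (x ⊗ₜ[k] (1 : K)) = Coalgebra.counit x)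
    (x : P ⊗[k] Pᵐᵒᵖ) :
    GammaMap k K P δK γ (x ⊗ₜ[k] (1 : P ⊗[k] Pᵐᵒᵖ)) = epsL k P x := by
  induction x using TensorProduct.induction_on with
  | zero => simp
  | add x x' hx hx' => simp only [add_tmul, map_add, hx, hx']
  | tmul p q =>
    simp [Algebra.TensorProduct.one_def, GammaMap_tmul, twistedProd_one hδK γ hγ, epsL]

/-- The map `A ⊗ H → P ⊗ H`,
`(p ⊗ q) ⊗ h ↦ γ(u₍₋₁₎, p₍₋₁₎) u₍₀₎ (p₍₀₎ ⊗ h) (q ⊗ 1) w`. -/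
def sandwich (δK : P →ₗ[k] K ⊗[k] P) (γ : K ⊗[k] K →ₗ[k] k) (u : K ⊗[k] (P ⊗[k] H))
    (w : P ⊗[k] H) : (P ⊗[k] Pᵐᵒᵖ) ⊗[k] H →ₗ[k] P ⊗[k] H :=
  LinearMap.mulRight k w ∘ₗ mul' k (P ⊗[k] H) ∘ₗ
    TensorProduct.map
      (twistedMul γ ∘ₗ TensorProduct.mk k _ _ u ∘ₗ
        (TensorProduct.assoc k K P H).toLinearMap ∘ₗ rTensor H δK)
      ((TensorProduct.mk k P H).flip 1 ∘ₗ (opLinearEquiv k (M := P)).symm.toLinearMap) ∘ₗ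
    (TensorProduct.rightComm k P Pᵐᵒᵖ H).toLinearMap

theorem sandwich_tmul (δK : P →ₗ[k] K ⊗[k] P) (γ : K ⊗[k] K →ₗ[k] k)
    (u : K ⊗[k] (P ⊗[k] H)) (w : P ⊗[k] H) (p : P) (q : Pᵐᵒᵖ) (h : H) :
    sandwich δK γ u w ((p ⊗ₜ[k] q) ⊗ₜ[k] h)
      = twistedMul γ (u ⊗ₜ[k] TensorProduct.assoc k K P H (δK p ⊗ₜ[k] h))
        * (unop q ⊗ₜ[k] (1 : H)) * w := by
  simp [sandwich]

theorem twistedMul_assoc_mul_tmul (γ : K ⊗[k] K →ₗ[k] k) (u : K ⊗[k] (P ⊗[k] H))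
    (v : K ⊗[k] P) (q : P) (h h' : H) :
    twistedMul γ (u ⊗ₜ[k] TensorProduct.assoc k K P H (v ⊗ₜ[k] h)) * (q ⊗ₜ[k] h')
      = twistedMul γ (u ⊗ₜ[k] TensorProduct.assoc k K P H (v ⊗ₜ[k] (h * h')))
        * (q ⊗ₜ[k] (1 : H)) := by
  induction v using TensorProduct.induction_on with
  | zero => simp
  | add v v' hv hv' => simp only [add_tmul, tmul_add, map_add, add_mul, hv, hv']
  | tmul b n =>
    induction u using TensorProduct.induction_on with
    | zero => simp
    | add u u' hu hu' => simp only [add_tmul, map_add, add_mul, hu, hu']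
    | tmul a m => simp [mul_assoc]

theorem sandwich_codiagCoaction (δ : P →ₗ[k] P ⊗[k] H) (δK : P →ₗ[k] K ⊗[k] P)
    (γ : K ⊗[k] K →ₗ[k] k) (u : K ⊗[k] (P ⊗[k] H)) (w : P ⊗[k] H) (p : P) (q : Pᵐᵒᵖ) :
    sandwich δK γ u w (codiagCoaction k H P δ (p ⊗ₜ[k] q))
      = twistedMul γ (u ⊗ₜ[k] TensorProduct.assoc k K P H (rTensor H δK (δ p)))
        * δ (unop q) * w := by
  have key (s t : P ⊗[k] H) : sandwich δK γ u w (lTensor (P ⊗[k] Pᵐᵒᵖ) (mul' k H)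
      (TensorProduct.tensorTensorTensorComm k P H Pᵐᵒᵖ H
        (s ⊗ₜ[k] rTensor H (opLinearEquiv k (M := P)).toLinearMap t)))
      = twistedMul γ (u ⊗ₜ[k] TensorProduct.assoc k K P H (rTensor H δK s)) * t * w := by
    induction s using TensorProduct.induction_on with
    | zero => simp
    | add s s' hs hs' => simp only [add_tmul, tmul_add, map_add, add_mul, hs, hs']
    | tmul m h =>
      induction t using TensorProduct.induction_on with
      | zero => simp
      | add t t' ht ht' => simp only [tmul_add, map_add, add_mul, mul_add, ht, ht']
      | tmul n h' =>
        simp only [rTensor_tmul, tensorTensorTensorComm_tmul, lTensor_tmul, mul'_apply,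
          sandwich_tmul, twistedMul_assoc_mul_tmul γ u (δK m) n h h']
        simp
  exact key (δ p) (δ (unop q))

theorem sandwich_tmul_one (δ : P →ₗ[k] P ⊗[k] H) (δK : P →ₗ[k] K ⊗[k] P)
    (γ : K ⊗[k] K →ₗ[k] k) (p : P) (q : Pᵐᵒᵖ) (y : P ⊗[k] Pᵐᵒᵖ) :
    sandwich δK γ (TensorProduct.assoc k K P H (rTensor H δK (δ p))) (δ (unop q))
        (y ⊗ₜ[k] (1 : H))
      = rTensor H (GammaMap k K P δK γ ∘ₗ (TensorProduct.mk k _ _).flip y)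
        (codiagCoaction k H P δ (p ⊗ₜ[k] q)) := by
  induction y using TensorProduct.induction_on with
  | zero => simp
  | add y y' hy hy' =>
    simp only [add_tmul, map_add, comp_add, rTensor_add, LinearMap.add_apply, hy, hy']
  | tmul p' q' =>
    have hmul (u v : K ⊗[k] P) (r r' : P) (h h' : H) :
        twistedMul γ (TensorProduct.assoc k K P H (u ⊗ₜ[k] h) ⊗ₜ[k]
            TensorProduct.assoc k K P H (v ⊗ₜ[k] (1 : H)))
          * (r' ⊗ₜ[k] (1 : H)) * (r ⊗ₜ[k] h')
        = (twistedMul γ (u ⊗ₜ[k] v) * (r' * r)) ⊗ₜ[k] (h * h') := by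
      induction u using TensorProduct.induction_on with
      | zero => simp
      | add u u' hu hu' => simp only [add_tmul, map_add, add_mul, hu, hu']
      | tmul a m =>
        induction v using TensorProduct.induction_on with
        | zero => simp
        | add v v' hv hv' => simp only [add_tmul, tmul_add, map_add, add_mul, hv, hv']
        | tmul b n => simp [mul_assoc, smul_tmul']
    have key (s t : P ⊗[k] H) :
        sandwich δK γ (TensorProduct.assoc k K P H (rTensor H δK s)) t
          ((p' ⊗ₜ[k] q') ⊗ₜ[k] (1 : H))
        = rTensor H (GammaMap k K P δK γ ∘ₗ (TensorProduct.mk k _ _).flip (p' ⊗ₜ[k] q'))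
          (lTensor (P ⊗[k] Pᵐᵒᵖ) (mul' k H)
            (TensorProduct.tensorTensorTensorComm k P H Pᵐᵒᵖ H
              (s ⊗ₜ[k] rTensor H (opLinearEquiv k (M := P)).toLinearMap t))) := by
      rw [sandwich_tmul]
      induction s using TensorProduct.induction_on with
      | zero => simp
      | add s s' hs hs' => simp only [add_tmul, map_add, add_mul, hs, hs']
      | tmul m h =>
        induction t using TensorProduct.induction_on with
        | zero => simp
        | add t t' ht ht' => simp only [tmul_add, map_add, mul_add, ht, ht']
        | tmul n h' =>
          simp only [rTensor_tmul, hmul]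
          simp [GammaMap_tmul, twistedProd_apply]
    exact key (δ p) (δ (unop q))

theorem GammaMap_mem_coinv {δ : P →ₗ[k] P ⊗[k] H}
    (hδ : ∀ p q : P, δ (p * q) = δ p * δ q) {δK : P →ₗ[k] K ⊗[k] P}
    (hcomm : ∀ p : P, (lTensor K δ) (δK p)
        = (TensorProduct.assoc k K P H) ((rTensor H δK) (δ p)))
    (γ : K ⊗[k] K →ₗ[k] k) {x y : P ⊗[k] Pᵐᵒᵖ} (hx : x ∈ ehresmann k H P δ)
    (hy : y ∈ ehresmann k H P δ) :
    GammaMap k K P δK γ (x ⊗ₜ[k] y) ∈ coinv k H P δ := by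
  have hpure (p : P) (q : Pᵐᵒᵖ) (y : P ⊗[k] Pᵐᵒᵖ) :
      δ (GammaMap k K P δK γ ((p ⊗ₜ[k] q) ⊗ₜ[k] y))
      = sandwich δK γ (TensorProduct.assoc k K P H (rTensor H δK (δ p))) (δ (unop q))
        (codiagCoaction k H P δ y) := by
    induction y using TensorProduct.induction_on with
    | zero => simp
    | add y y' hy hy' => simp only [tmul_add, map_add, hy, hy']
    | tmul p' q' =>
      rw [sandwich_codiagCoaction, GammaMap_tmul, hδ, hδ, twistedProd_apply,
        map_twistedMul γ δ hδ, hcomm, hcomm, mul_assoc]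
  have hleft (x : P ⊗[k] Pᵐᵒᵖ) : δ (GammaMap k K P δK γ (x ⊗ₜ[k] y))
      = rTensor H (GammaMap k K P δK γ ∘ₗ (TensorProduct.mk k _ _).flip y)
        (codiagCoaction k H P δ x) := by
    induction x using TensorProduct.induction_on with
    | zero => simp
    | add x x' hx hx' => simp only [add_tmul, map_add, hx, hx']
    | tmul p q => rw [hpure, show codiagCoaction k H P δ y = y ⊗ₜ[k] (1 : H) from hy,
        sandwich_tmul_one]
  rw [coinv, Set.mem_ofPred_eq, hleft,
    show codiagCoaction k H P δ x = x ⊗ₜ[k] (1 : H) from hx]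
  simp

end Ehresmann

theorem induced_cocycle_on_ehresmann
    (δ : P →ₗ[k] P ⊗[k] H) (hδ : IsComodAlg k H P δ)
    (δK : P →ₗ[k] K ⊗[k] P) (hδK : IsLeftComodAlg k K P δK)
    (hcomm : ∀ p : P, (lTensor K δ) (δK p)
        = (TensorProduct.assoc k K P H) ((rTensor H δK) (δ p)))
    (hGal : IsGaloisExt k H P δ)
    (τ : H →ₗ[k] P ⊗[k] P)
    (hτ : ∀ h : H, canMap k H P δ (τ h) = (1 : P) ⊗ₜ[k] h)
    (γ γinv : K ⊗[k] K →ₗ[k] k) (hγ : IsTwoCocycle k K γ γinv) :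
    -- `Γ` maps `L(P,H) ⊗ L(P,H)` into `B`:
    (∀ x ∈ ehresmann k H P δ, ∀ y ∈ ehresmann k H P δ,
      GammaMap k K P δK γ (x ⊗ₜ[k] y) ∈ coinv k H P δ) ∧
    -- unitality: `Γ(1, X) = ε(X) = Γ(X, 1)`:
    (∀ x ∈ ehresmann k H P δ,
      GammaMap k K P δK γ ((1 : P ⊗[k] Pᵐᵒᵖ) ⊗ₜ[k] x) = epsL k P x ∧
      GammaMap k K P δK γ (x ⊗ₜ[k] (1 : P ⊗[k] Pᵐᵒᵖ)) = epsL k P x) ∧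
    -- the 2-cocycle condition `Γ(X, Γ(Y₁,Z₁) Y₂ Z₂) = Γ(Γ(X₁,Y₁) X₂ Y₂, Z)`:
    (∀ x ∈ ehresmann k H P δ, ∀ y ∈ ehresmann k H P δ,
      ∀ z ∈ ehresmann k H P δ,
      GammaMap k K P δK γ (x ⊗ₜ[k]
          cocyInner k K P δK γ ((deltaEhr k H P δ τ y) ⊗ₜ[k]
            (deltaEhr k H P δ τ z)))
        = GammaMap k K P δK γ
            ((cocyInner k K P δK γ ((deltaEhr k H P δ τ x) ⊗ₜ[k]
              (deltaEhr k H P δ τ y))) ⊗ₜ[k] z)) := by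
  obtain ⟨-, -, hcocycle, hone_left, hone_right⟩ := hγ
  exact ⟨fun x hx y hy => GammaMap_mem_coinv hδ.2.1 hcomm γ hx hy,
    fun x _ => ⟨GammaMap_one_left hδK hone_left x, GammaMap_one_right hδK hone_right x⟩,
    fun x _ y _ z _ => GammaMap_cocycle hδ.1 hδK hτ hcocycle x y z⟩

end
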